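/- arXiv:2408.14835 — 3 statements merged into one kernel-verified Lean document; each statement's English description precedes it below -/
import Mathlib

section
/- The integral 2·∫₀¹ log Γ(x) · sin(2πx) dx equals (γ + log(2π))/π, where γ is the Euler–Mascheroni constant. -/
open Real intervalIntegral

open MeasureTheory Filter Topology Set in
lemma aux_RL (f : ℝ → ℝ) (a b : ℝ) (hab : a ≤ b) (hf : IntervalIntegrable f volume a b) :
    Tendsto (fun M : ℕ => ∫ x in a..b, Real.cos (4 * M * x) * f x) atTop (𝓝 0) := by
  let F : ℝ → ℂ := (Ioc a b).indicator (fun x => (f x : ℂ))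
  have h := Real.tendsto_integral_exp_smul_cocompact F
  have hw : Tendsto (fun M : ℕ => (4 * (M : ℝ)) / (2 * π)) atTop (cocompact ℝ) := by
    refine Tendsto.mono_right ?_ atTop_le_cocompact
    refine Tendsto.atTop_div_const (by positivity) ?_
    exact Tendsto.const_mul_atTop (by norm_num) tendsto_natCast_atTop_atTop
  have h2 := (Complex.continuous_re.tendsto _).comp (h.comp hw)
  rw [Complex.zero_re] at h2
  refine h2.congr fun M => ?_
  have hFi : Integrable F := by
    rw [integrable_indicator_iff measurableSet_Ioc]
    exact ((intervalIntegrable_iff_integrableOn_Ioc_of_le hab).1 hf).ofReal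
  have hint : Integrable (fun v : ℝ => Real.fourierChar (-(v * ((4 * (M : ℝ)) / (2 * π)))) • F v) := by
    have := (Real.fourierIntegral_convergent_iff (μ := volume) (f := F) ((4 * (M : ℝ)) / (2 * π))).2 hFi
    simpa [mul_comm] using this
  simp only [Function.comp]
  rw [← Complex.reCLM_apply, ← ContinuousLinearMap.integral_comp_comm _ hint,
    intervalIntegral.integral_of_le hab, ← MeasureTheory.integral_indicator measurableSet_Ioc]
  congr 1
  ext v
  by_cases hv : v ∈ Ioc a b
  · simp only [F, indicator_of_mem hv, Circle.smul_def, Real.fourierChar_apply, Complex.reCLM_apply,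
      smul_eq_mul, Complex.re_mul_ofReal]
    congr 1
    rw [Complex.exp_ofReal_mul_I_re, ← Real.cos_neg]
    congr 1
    field_simp
  · simp [F, indicator_of_notMem hv]

lemma aux_g_deriv (x : ℝ) (hx : x ∈ Set.Ioo 0 (π / 2)) :
    HasDerivAt (fun t => - Real.log (Real.sinc t)) (1 / x - Real.cos x / Real.sin x) x := by
  have hs : 0 < Real.sin x := Real.sin_pos_of_pos_of_lt_pi hx.1 (by linarith [hx.2, Real.pi_pos])
  have h1 : HasDerivAt (fun t => Real.log t - Real.log (Real.sin t))
      (1 / x - Real.cos x / Real.sin x) x := by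
    have := (Real.hasDerivAt_log hx.1.ne').sub ((Real.hasDerivAt_sin x).log hs.ne')
    simpa [one_div] using! this
  refine h1.congr_of_eventuallyEq ?_
  filter_upwards [isOpen_Ioo.mem_nhds hx] with t ht
  have hs : 0 < Real.sin t := Real.sin_pos_of_pos_of_lt_pi ht.1 (by linarith [ht.2, Real.pi_pos])
  rw [Real.sinc_of_ne_zero ht.1.ne', Real.log_div hs.ne' ht.1.ne']
  ring

lemma aux_sinc_pos (x : ℝ) (hx : x ∈ Set.Icc 0 (π / 2)) : 0 < Real.sinc x := by
  rcases hx.1.eq_or_lt with h | h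
  · rw [← h]; simp
  · rw [Real.sinc_of_ne_zero h.ne']
    exact div_pos (Real.sin_pos_of_pos_of_lt_pi h (by linarith [hx.2, Real.pi_pos])) h

lemma aux_g_cont : ContinuousOn (fun t => - Real.log (Real.sinc t)) (Set.Icc 0 (π / 2)) :=
  (Real.continuous_sinc.continuousOn.log fun x hx => (aux_sinc_pos x hx).ne').neg

lemma aux_g_int : IntervalIntegrable (fun x => 1 / x - Real.cos x / Real.sin x)
    MeasureTheory.volume 0 (π / 2) := by
  have hp : (0 : ℝ) ≤ π / 2 := by positivity
  rw [intervalIntegrable_iff_integrableOn_Ioc_of_le hp]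
  refine integrableOn_deriv_of_nonneg aux_g_cont aux_g_deriv fun x hx => ?_
  have hs : 0 < Real.sin x := Real.sin_pos_of_pos_of_lt_pi hx.1 (by linarith [hx.2, Real.pi_pos])
  have hc : 0 < Real.cos x := Real.cos_pos_of_mem_Ioo ⟨by linarith [hx.1, Real.pi_pos], hx.2⟩
  have ht := Real.lt_tan hx.1 hx.2
  rw [Real.tan_eq_sin_div_cos, lt_div_iff₀ hc] at ht
  rw [sub_nonneg, div_le_div_iff₀ hs hx.1]
  linarith

lemma aux_g_val : ∫ x in (0:ℝ)..(π / 2), (1 / x - Real.cos x / Real.sin x)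
    = Real.log (π / 2) := by
  rw [integral_eq_sub_of_hasDerivAt_of_le (by positivity) aux_g_cont aux_g_deriv aux_g_int]
  rw [Real.sinc_of_ne_zero (by positivity), Real.sin_pi_div_two, Real.sinc_zero, Real.log_one,
    one_div, Real.log_inv]
  ring

/-- the kernel -/
noncomputable def auxK (M : ℕ) (x : ℝ) : ℝ :=
  ∑ j ∈ Finset.range M, (2 * Real.sin ((4 * j + 2) * x) + Real.sin ((4 * j + 4) * x)
    + Real.sin (4 * j * x))

lemma auxK_cont (M : ℕ) : Continuous (auxK M) := by
  unfold auxK; fun_prop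

lemma auxK_eq (M : ℕ) (x : ℝ) :
    (1 - Real.cos (4 * M * x)) * Real.cos x = Real.sin x * auxK M x := by
  induction M with
  | zero => simp [auxK]
  | succ M ih =>
    have : auxK (M + 1) x = auxK M x + (2 * Real.sin ((4 * M + 2) * x)
      + Real.sin ((4 * M + 4) * x) + Real.sin (4 * M * x)) := by
      simp [auxK, Finset.sum_range_succ]
    rw [this, mul_add, ← ih]
    have e1 : (4 * (M : ℝ) + 2) * x = 4 * M * x + 2 * x := by ring
    have e2 : (4 * (M : ℝ) + 4) * x = 4 * M * x + 2 * (2 * x) := by ring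
    have e3 : (4 * ((M + 1 : ℕ) : ℝ)) * x = 4 * M * x + 2 * (2 * x) := by push_cast; ring
    rw [e1, e2, e3]
    generalize 4 * (M : ℝ) * x = y
    simp only [Real.cos_add, Real.sin_add, Real.cos_two_mul, Real.sin_two_mul]
    have hs := Real.sin_sq_add_cos_sq x
    have hs' : Real.sin x ^ 2 = 1 - Real.cos x ^ 2 := by linarith
    ring_nf
    simp only [show Real.sin x ^ 3 = Real.sin x * Real.sin x ^ 2 by ring, hs']
    ring

lemma aux_int_sin (c : ℝ) (hc : c ≠ 0) :
    ∫ x in (0:ℝ)..(π / 2), Real.sin (c * x) = (1 - Real.cos (c * (π / 2))) / c := by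
  rw [intervalIntegral.integral_comp_mul_left (fun x => Real.sin x) hc]
  simp
  field_simp

lemma auxK_int (M : ℕ) : ∫ x in (0:ℝ)..(π / 2), auxK M x
    = ∑ j ∈ Finset.range M, 2 / (2 * (j : ℝ) + 1) := by
  unfold auxK
  rw [intervalIntegral.integral_finsetSum fun i _ =>
    (Continuous.intervalIntegrable (by fun_prop) _ _)]
  refine Finset.sum_congr rfl fun j _ => ?_
  rw [intervalIntegral.integral_add (Continuous.intervalIntegrable (by fun_prop) _ _)
    (Continuous.intervalIntegrable (by fun_prop) _ _),
    intervalIntegral.integral_add (Continuous.intervalIntegrable (by fun_prop) _ _)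
    (Continuous.intervalIntegrable (by fun_prop) _ _), intervalIntegral.integral_const_mul,
    aux_int_sin _ (by positivity), aux_int_sin _ (by positivity)]
  have e1 : Real.cos ((4 * (j : ℝ) + 2) * (π / 2)) = -1 := by
    rw [show (4 * (j : ℝ) + 2) * (π / 2) = π + j * (2 * π) by ring, Real.cos_add_nat_mul_two_pi,
      Real.cos_pi]
  have e2 : Real.cos ((4 * (j : ℝ) + 4) * (π / 2)) = 1 := by
    rw [show (4 * (j : ℝ) + 4) * (π / 2) = (j + 1 : ℕ) * (2 * π) by push_cast; ring,
      Real.cos_nat_mul_two_pi]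
  have e3 : ∫ x in (0:ℝ)..(π / 2), Real.sin (4 * j * x) = 0 := by
    rcases Nat.eq_zero_or_pos j with h | h
    · simp [h]
    · rw [aux_int_sin _ (by positivity), show (4 * (j : ℝ)) * (π / 2) = j * (2 * π) by ring,
        Real.cos_nat_mul_two_pi]
      simp
  rw [e1, e2, e3]
  have : (2 * (j : ℝ) + 1) ≠ 0 := by positivity
  have : (4 * (j : ℝ) + 2) ≠ 0 := by positivity
  field_simp
  ring

lemma aux_harm (M : ℕ) : ∑ j ∈ Finset.range M, 2 / (2 * (j : ℝ) + 1)
    = 2 * (harmonic (2 * M) : ℝ) - harmonic M := by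
  induction M with
  | zero => simp
  | succ M ih =>
    rw [Finset.sum_range_succ, ih, show 2 * (M + 1) = 2 * M + 1 + 1 by ring, harmonic_succ,
      harmonic_succ, harmonic_succ]
    push_cast
    field_simp
    ring

open MeasureTheory Filter Topology in
lemma aux_A_lim : Tendsto (fun M : ℕ =>
      (∫ x in (0:ℝ)..(π / 2), (1 - Real.cos (4 * M * x)) / x) - Real.log M) atTop
      (𝓝 (Real.eulerMascheroniConstant + Real.log (2 * π))) := by
  have hp : (0 : ℝ) ≤ π / 2 := by positivity
  have key : ∀ M : ℕ, ∫ x in (0:ℝ)..(π / 2), (1 - Real.cos (4 * M * x)) / x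
      = Real.log (π / 2)
        - (∫ x in (0:ℝ)..(π / 2), Real.cos (4 * M * x) * (1 / x - Real.cos x / Real.sin x))
        + (2 * (harmonic (2 * M) : ℝ) - harmonic M) := by
    intro M
    have hci : IntervalIntegrable
        (fun x => Real.cos (4 * M * x) * (1 / x - Real.cos x / Real.sin x)) volume 0 (π / 2) :=
      aux_g_int.continuousOn_mul (Continuous.continuousOn (by fun_prop))
    rw [← aux_harm, ← auxK_int, ← aux_g_val, ← intervalIntegral.integral_sub aux_g_int hci,
      ← intervalIntegral.integral_add (aux_g_int.sub hci) ((auxK_cont M).intervalIntegrable _ _)]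
    refine intervalIntegral.integral_congr_ae (Eventually.of_forall fun x hx => ?_)
    rw [Set.uIoc_of_le hp] at hx
    have hs : Real.sin x ≠ 0 :=
      (Real.sin_pos_of_pos_of_lt_pi hx.1 (by linarith [hx.2, Real.pi_pos])).ne'
    have : auxK M x = (1 - Real.cos (4 * M * x)) * Real.cos x / Real.sin x := by
      rw [auxK_eq]; field_simp
    rw [this]
    ring
  have hRL := aux_RL _ 0 (π / 2) hp aux_g_int
  have h1 := Real.tendsto_harmonic_sub_log
  have h2 := h1.comp (tendsto_id.const_mul_atTop' (show 0 < 2 by norm_num) : Tendsto (fun M : ℕ => 2 * M) atTop atTop)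
  have h3 := ((tendsto_const_nhds (x := Real.log (π / 2) + 2 * Real.log 2)).sub hRL).add
    ((h2.const_mul 2).sub h1)
  have e : Real.log (π / 2) + 2 * Real.log 2 - 0 + (2 * Real.eulerMascheroniConstant
      - Real.eulerMascheroniConstant) = Real.eulerMascheroniConstant + Real.log (2 * π) := by
    rw [Real.log_div (by positivity) (by norm_num), Real.log_mul (by norm_num) (by positivity)]
    ring
  rw [e] at h3
  refine h3.congr' ?_
  filter_upwards [eventually_gt_atTop 0] with M hM
  have hM' : (M : ℝ) ≠ 0 := by positivity
  rw [key]
  simp only [Function.comp]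
  push_cast
  rw [Real.log_mul (by norm_num) hM']
  ring

lemma aux_cos (x : ℝ) : 1 - Real.cos (2 * π * x)
    = 2 * π * x * (Real.sin (π * x) * Real.sinc (π * x)) := by
  rcases eq_or_ne x 0 with rfl | h
  · simp
  · rw [Real.sinc_of_ne_zero (by positivity), show 2 * π * x = 2 * (π * x) by ring,
      Real.cos_two_mul']
    have := Real.sin_sq_add_cos_sq (π * x)
    field_simp
    linarith

open MeasureTheory Filter Topology in
lemma aux_log_int (M : ℕ) (hM : 0 < M) :
    ∫ x in (0:ℝ)..M, Real.log x * Real.sin (2 * π * x)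
      = - (1 / (2 * π)) * ∫ x in (0:ℝ)..(π / 2), (1 - Real.cos (4 * M * x)) / x := by
  have hM' : (0 : ℝ) < M := by exact_mod_cast hM
  have hcs : Continuous (fun x => Real.sin (π * x) * Real.sinc (π * x)) := by
    have := Real.continuous_sinc
    fun_prop
  have hF : Continuous (fun x => (x * Real.log x) * (Real.sin (π * x) * Real.sinc (π * x))) :=
    Real.continuous_mul_log.mul hcs
  have hFe : (fun x => (x * Real.log x) * (Real.sin (π * x) * Real.sinc (π * x)))
      = fun x => Real.log x * ((1 - Real.cos (2 * π * x)) / (2 * π)) := by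
    ext x; rw [aux_cos]; field_simp
  have hi1 : IntervalIntegrable (fun x => Real.log x * Real.sin (2 * π * x)) volume 0 M :=
    intervalIntegrable_log'.mul_continuousOn (Continuous.continuousOn (by fun_prop))
  have hd : ∀ x ∈ Set.Ioo (0:ℝ) M, HasDerivAt
      (fun x => (x * Real.log x) * (Real.sin (π * x) * Real.sinc (π * x)))
      (Real.log x * Real.sin (2 * π * x) + Real.sin (π * x) * Real.sinc (π * x)) x := by
    intro x hx
    rw [hFe]
    have hx0 : x ≠ 0 := hx.1.ne'
    have h1 : HasDerivAt (fun x => (1 - Real.cos (2 * π * x)) / (2 * π))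
        (Real.sin (2 * π * x)) x := by
      have h0 : HasDerivAt (fun x : ℝ => 2 * π * x) (2 * π) x := by
        simpa using (hasDerivAt_id x).const_mul (2 * π)
      have := ((h0.cos).const_sub 1).div_const (2 * π)
      convert! this using 1
      field_simp
    have := (Real.hasDerivAt_log hx0).mul h1
    convert! this using 1
    rw [aux_cos]
    field_simp
    ring
  have hI := integral_eq_sub_of_hasDerivAt_of_le hM'.le hF.continuousOn hd
    (hi1.add (hcs.intervalIntegrable _ _))
  rw [intervalIntegral.integral_add hi1 (hcs.intervalIntegrable _ _)] at hI
  have hz : Real.sin (π * M) = 0 := by rw [mul_comm]; exact Real.sin_nat_mul_pi M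
  simp only [hz, zero_mul, mul_zero, sub_zero] at hI
  have hsub : ∫ x in (0:ℝ)..(π / 2), (1 - Real.cos (4 * M * x)) / x
      = ∫ x in (0:ℝ)..M, (1 - Real.cos (2 * π * x)) / x := by
    have hc : 2 * (M : ℝ) / π ≠ 0 := by positivity
    have := intervalIntegral.integral_comp_mul_left (a := 0) (b := π / 2)
      (fun x => (1 - Real.cos (2 * π * x)) / x) hc
    rw [show 2 * (M : ℝ) / π * (π / 2) = M by field_simp, mul_zero, smul_eq_mul,
      eq_inv_mul_iff_mul_eq₀ hc, ← intervalIntegral.integral_const_mul] at this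
    rw [← this]
    refine intervalIntegral.integral_congr fun x _ => ?_
    rw [show 2 * π * (2 * (M : ℝ) / π * x) = 4 * M * x by field_simp; ring]
    field_simp
  rw [hsub, ← intervalIntegral.integral_const_mul]
  rw [eq_neg_of_add_eq_zero_left hI, ← intervalIntegral.integral_neg]
  refine intervalIntegral.integral_congr_ae (Eventually.of_forall fun x hx => ?_)
  rw [Set.uIoc_of_le hM'.le] at hx
  have : x ≠ 0 := hx.1.ne'
  rw [aux_cos]
  field_simp

open MeasureTheory Filter Topology in
lemma aux_log_shift_int (m : ℕ) : IntervalIntegrable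
    (fun x => Real.log (x + m) * Real.sin (2 * π * x)) volume 0 1 := by
  have h : IntervalIntegrable (fun x : ℝ => Real.log (x + m)) volume 0 1 := by
    have := (intervalIntegrable_log' (a := (m : ℝ)) (b := 1 + m)).comp_add_right (m : ℝ)
    simpa using this
  exact h.mul_continuousOn (Continuous.continuousOn (by fun_prop))

open MeasureTheory Filter Topology in
lemma aux_x_sin : ∫ x in (0:ℝ)..1, x * Real.sin (2 * π * x) = - (1 / (2 * π)) := by
  have hd : ∀ x ∈ Set.uIcc (0:ℝ) 1, HasDerivAt
      (fun x => Real.sin (2 * π * x) / (2 * π) ^ 2 - x * Real.cos (2 * π * x) / (2 * π))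
      (x * Real.sin (2 * π * x)) x := by
    intro x _
    have h0 : HasDerivAt (fun x : ℝ => 2 * π * x) (2 * π) x := by
      simpa using (hasDerivAt_id x).const_mul (2 * π)
    have := (h0.sin.div_const ((2 * π) ^ 2)).sub
      (((hasDerivAt_id x).mul h0.cos).div_const (2 * π))
    convert! this using 1
    simp only [id]
    field_simp
    ring
  rw [integral_eq_sub_of_hasDerivAt hd (Continuous.intervalIntegrable (by fun_prop) _ _)]
  simp

lemma aux_sin : ∫ x in (0:ℝ)..1, Real.sin (2 * π * x) = 0 := by
  rw [intervalIntegral.integral_comp_mul_left (fun x => Real.sin x) (by positivity)]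
  simp

open MeasureTheory Filter Topology in
lemma aux_seq_int (n : ℕ) : IntervalIntegrable
    (fun x => Real.BohrMollerup.logGammaSeq x n * Real.sin (2 * π * x)) volume 0 1 ∧
    ∫ x in (0:ℝ)..1, Real.BohrMollerup.logGammaSeq x n * Real.sin (2 * π * x)
      = 1 / (2 * π) * ((∫ x in (0:ℝ)..(π / 2), (1 - Real.cos (4 * (n + 1 : ℕ) * x)) / x)
        - Real.log n) := by
  have he : (fun x => Real.BohrMollerup.logGammaSeq x n * Real.sin (2 * π * x))
      = fun x => (Real.log n * (x * Real.sin (2 * π * x))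
          + Real.log (n.factorial) * Real.sin (2 * π * x))
        - ∑ m ∈ Finset.range (n + 1), Real.log (x + m) * Real.sin (2 * π * x) := by
    ext x
    rw [Real.BohrMollerup.logGammaSeq, ← Finset.sum_mul]
    ring
  have i1 : IntervalIntegrable (fun x => Real.log n * (x * Real.sin (2 * π * x))) volume 0 1 :=
    Continuous.intervalIntegrable (by fun_prop) _ _
  have i2 : IntervalIntegrable (fun x => Real.log (n.factorial) * Real.sin (2 * π * x))
      volume 0 1 := Continuous.intervalIntegrable (by fun_prop) _ _
  have i3 : IntervalIntegrable (fun x => ∑ m ∈ Finset.range (n + 1),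
      Real.log (x + m) * Real.sin (2 * π * x)) volume 0 1 := by
    have := IntervalIntegrable.sum (Finset.range (n + 1)) fun m _ => aux_log_shift_int m
    simpa [Finset.sum_fn] using! this
  rw [he]
  refine ⟨(i1.add i2).sub i3, ?_⟩
  rw [intervalIntegral.integral_sub (i1.add i2) i3, intervalIntegral.integral_add i1 i2,
    intervalIntegral.integral_const_mul, intervalIntegral.integral_const_mul, aux_x_sin, aux_sin,
    intervalIntegral.integral_finsetSum fun m _ => aux_log_shift_int m]
  have hs : ∑ m ∈ Finset.range (n + 1), ∫ x in (0:ℝ)..1, Real.log (x + m) * Real.sin (2 * π * x)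
      = ∫ x in (0:ℝ)..((n + 1 : ℕ) : ℝ), Real.log x * Real.sin (2 * π * x) := by
    have hh := intervalIntegral.sum_integral_adjacent_intervals (μ := volume)
      (f := fun x => Real.log x * Real.sin (2 * π * x)) (a := fun k : ℕ => (k : ℝ)) (n := n + 1)
      (fun k _ => intervalIntegrable_log'.mul_continuousOn (Continuous.continuousOn (by fun_prop)))
    rw [Nat.cast_zero] at hh
    rw [← hh]
    refine Finset.sum_congr rfl fun m _ => ?_
    have := intervalIntegral.integral_comp_add_right (a := 0) (b := 1)
      (fun x => Real.log x * Real.sin (2 * π * x)) (m : ℝ)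
    rw [zero_add, add_comm 1 (m : ℝ)] at this
    push_cast
    rw [← this]
    refine intervalIntegral.integral_congr fun x _ => ?_
    rw [show 2 * π * (x + m) = 2 * π * x + m * (2 * π) by ring, Real.sin_add_nat_mul_two_pi]
  rw [hs, aux_log_int _ (Nat.succ_pos n)]
  ring

open MeasureTheory Filter Topology in
lemma aux_gamma_int : IntervalIntegrable
    (fun x => Real.log (Real.Gamma x) * Real.sin (2 * π * x)) volume 0 1 := by
  refine IntervalIntegrable.mul_continuousOn ?_ (Continuous.continuousOn (by fun_prop))
  have h1 : IntervalIntegrable (fun x => Real.log (Real.Gamma (x + 1))) volume 0 1 := by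
    refine ContinuousOn.intervalIntegrable fun x hx => ContinuousAt.continuousWithinAt ?_
    rw [Set.uIcc_of_le zero_le_one] at hx
    have hp : 0 < x + 1 := by linarith [hx.1]
    have hg : ContinuousAt Real.Gamma (x + 1) :=
      (Real.differentiableAt_Gamma fun m => by
        have : (0 : ℝ) ≤ m := Nat.cast_nonneg m
        intro h; linarith).continuousAt
    exact (ContinuousAt.comp (f := fun x : ℝ => x + 1) hg (by fun_prop)).log
      (Real.Gamma_pos_of_pos hp).ne'
  refine (h1.sub (intervalIntegrable_log' (a := 0) (b := 1))).congr ?_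
  intro x hx
  rw [Set.uIoc_of_le zero_le_one] at hx
  simp only
  rw [Real.Gamma_add_one hx.1.ne', Real.log_mul hx.1.ne' (Real.Gamma_pos_of_pos hx.1).ne']
  ring

open MeasureTheory Filter Topology in
lemma aux_bound (n : ℕ) (hn : n ≠ 0) (x : ℝ) (hx : x ∈ Set.Ioc (0:ℝ) 1) :
    |Real.log (Real.Gamma x) - Real.BohrMollerup.logGammaSeq x n|
      ≤ Real.log (n + 1) - Real.log n := by
  have hfeq : ∀ {y : ℝ}, 0 < y → (Real.log ∘ Real.Gamma) (y + 1)
      = (Real.log ∘ Real.Gamma) y + Real.log y := by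
    intro y hy
    rw [Function.comp_apply, Real.Gamma_add_one hy.ne',
      Real.log_mul hy.ne' (Real.Gamma_pos_of_pos hy).ne', add_comm, Function.comp_apply]
  have h1 := Real.BohrMollerup.le_logGammaSeq Real.convexOn_log_Gamma hfeq hx.1 hx.2 n
  have h2 := Real.BohrMollerup.ge_logGammaSeq Real.convexOn_log_Gamma hfeq hx.1 hn
  simp only [Function.comp_apply, Real.Gamma_one, Real.log_one] at h1 h2
  have hn' : (0 : ℝ) < n := by positivity
  have h3 : Real.log n ≤ Real.log (n + 1) := Real.log_le_log hn' (by linarith)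
  rw [abs_le]
  constructor <;> nlinarith [hx.1, hx.2]

open MeasureTheory Filter Topology in
theorem aux_main :
    ∫ x in (0:ℝ)..1, Real.log (Real.Gamma x) * Real.sin (2 * π * x)
      = 1 / (2 * π) * (Real.eulerMascheroniConstant + Real.log (2 * π)) := by
  have l1 : Tendsto (fun n : ℕ => ∫ x in (0:ℝ)..1,
      Real.BohrMollerup.logGammaSeq x n * Real.sin (2 * π * x)) atTop
      (𝓝 (1 / (2 * π) * (Real.eulerMascheroniConstant + Real.log (2 * π)))) := by
    have := (aux_A_lim.comp (tendsto_add_atTop_nat 1)).add Real.tendsto_log_nat_add_one_sub_log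
    rw [add_zero] at this
    refine (this.const_mul (1 / (2 * π))).congr fun n => ?_
    rw [(aux_seq_int n).2]
    simp only [Function.comp]
    push_cast
    ring
  refine tendsto_nhds_unique ?_ l1
  rw [tendsto_iff_norm_sub_tendsto_zero]
  refine squeeze_zero' (Eventually.of_forall fun n => norm_nonneg _) ?_
    Real.tendsto_log_nat_add_one_sub_log
  filter_upwards [eventually_ne_atTop 0] with n hn
  rw [norm_sub_rev, ← intervalIntegral.integral_sub aux_gamma_int (aux_seq_int n).1]
  have := intervalIntegral.norm_integral_le_of_norm_le_const (a := 0) (b := 1)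
    (C := Real.log (n + 1) - Real.log n)
    (f := fun x => Real.log (Real.Gamma x) * Real.sin (2 * π * x)
      - Real.BohrMollerup.logGammaSeq x n * Real.sin (2 * π * x)) (by
    intro x hx
    rw [Set.uIoc_of_le zero_le_one] at hx
    rw [← sub_mul, Real.norm_eq_abs, abs_mul]
    calc _ ≤ _ * 1 := mul_le_mul_of_nonneg_left (Real.abs_sin_le_one _) (abs_nonneg _)
      _ ≤ _ := by rw [mul_one]; exact aux_bound n hn x hx)
  simpa using this

theorem farhi_eta :
    2 * ∫ x in (0:ℝ)..1, Real.log (Real.Gamma x) * Real.sin (2 * π * x)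
      = (Real.eulerMascheroniConstant + Real.log (2 * π)) / π := by
  rw [aux_main]
  field_simp
end

section
/- ∫₀¹ log Γ(x) · sin(2πx) dx = ∫₀^∞ [4π²(1 - e^{-t}) - t²·e^{-t}] / (2π·t·(4π² + t²)) dt. -/
open Real

namespace MalmstenAux

open Set Filter MeasureTheory Topology

lemma frul_int_le {a b : ℝ} (ha : 0 < a) (hab : a ≤ b) :
    IntegrableOn (fun t : ℝ => t⁻¹ * (exp (-(a * t)) - exp (-(b * t)))) (Ioi 0) := by
  have h1 : IntegrableOn (fun t : ℝ => (b - a) * exp (-a * t)) (Ioi 0) :=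
    (integrableOn_exp_mul_Ioi (by linarith) 0).const_mul _
  refine Integrable.mono' h1 ?_ ?_
  · exact (by fun_prop : Measurable _).aestronglyMeasurable
  · refine (ae_restrict_mem measurableSet_Ioi).mono fun t ht => ?_
    have ht : 0 < t := ht
    have e : exp (-(b * t)) = exp (-(a * t)) * exp (-((b - a) * t)) := by
      rw [← exp_add]; congr 1; ring
    have h2 : 1 - (b - a) * t ≤ exp (-((b - a) * t)) := by
      have := add_one_le_exp (-((b - a) * t)); linarith
    have h3 : exp (-((b - a) * t)) ≤ 1 := by
      apply exp_le_one_iff.2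
      have : 0 ≤ (b - a) * t := mul_nonneg (by linarith) ht.le
      linarith
    have h4 := exp_pos (-(a * t))
    rw [e, norm_eq_abs, abs_of_nonneg, neg_mul, inv_mul_le_iff₀ ht]
    · nlinarith
    · apply mul_nonneg (by positivity)
      nlinarith

lemma frul_int {a b : ℝ} (ha : 0 < a) (hb : 0 < b) :
    IntegrableOn (fun t : ℝ => t⁻¹ * (exp (-(a * t)) - exp (-(b * t)))) (Ioi 0) := by
  rcases le_total a b with h | h
  · exact frul_int_le ha h
  · convert (frul_int_le hb h).neg using 2
    simp only [Pi.neg_apply]; ring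

lemma frul_val {a b : ℝ} (ha : 0 < a) (hb : 0 < b) :
    ∫ t in Ioi (0:ℝ), t⁻¹ * (exp (-(a * t)) - exp (-(b * t))) = log (b / a) := by
  have := Frullani.integral_Ioi_eq (f := fun t : ℝ => exp (-t)) (L := 1) (R := 0) (a := a) (b := b)
    ((by fun_prop : Continuous _).locallyIntegrable.locallyIntegrableOn _) ha hb ?_ ?_ ?_
  · simpa using this
  · have : Tendsto (fun t : ℝ => exp (-t)) (𝓝 0) (𝓝 (exp (-0))) :=
      (by fun_prop : Continuous fun t : ℝ => exp (-t)).tendsto 0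
    simp only [neg_zero, exp_zero] at this
    exact this.mono_left nhdsWithin_le_nhds
  · exact tendsto_exp_neg_atTop_nhds_zero
  · simpa using frul_int ha hb

/-- Malmsten kernel. -/
noncomputable def G (x t : ℝ) : ℝ :=
  t⁻¹ * ((x - 1) * exp (-t) + (exp (-(x * t)) - exp (-t)) / (1 - exp (-t)))

lemma one_sub_pos {t : ℝ} (ht : 0 < t) : 0 < 1 - exp (-t) := by
  have : exp (-t) < 1 := by
    rw [← exp_zero]; exact exp_lt_exp.2 (by linarith)
  linarith

lemma G_rec {x t : ℝ} (ht : 0 < t) :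
    G (x + 1) t = G x t + t⁻¹ * (exp (-(1 * t)) - exp (-(x * t))) := by
  have h := (one_sub_pos ht).ne'
  have e : exp (-((x + 1) * t)) = exp (-(x * t)) * exp (-t) := by
    rw [← exp_add]; congr 1; ring
  unfold G
  rw [e, one_mul]
  field_simp
  ring

lemma G_conv {t : ℝ} (ht : 0 < t) : ConvexOn ℝ univ (fun x => G x t) := by
  refine ⟨convex_univ, fun x _ y _ a b ha hb hab => ?_⟩
  have h := one_sub_pos ht
  have := convexOn_exp.2 (mem_univ (-(x * t))) (mem_univ (-(y * t))) ha hb hab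
  simp only [smul_eq_mul] at this ⊢
  have e : -((a * x + b * y) * t) = a * -(x * t) + b * -(y * t) := by ring
  unfold G
  rw [e]
  have hb' : b = 1 - a := by linarith
  have : t⁻¹ * ((a * x + b * y - 1) * exp (-t) +
      (exp (a * -(x * t) + b * -(y * t)) - exp (-t)) / (1 - exp (-t))) ≤
      t⁻¹ * ((a * x + b * y - 1) * exp (-t) +
      (a * exp (-(x * t)) + b * exp (-(y * t)) - exp (-t)) / (1 - exp (-t))) := by
    gcongr
  refine this.trans (le_of_eq ?_)
  subst hb'
  ring

lemma G_cvx {t : ℝ} (ht : 0 < t) (x y a b : ℝ) (ha : 0 ≤ a) (hb : 0 ≤ b) (hab : a + b = 1) :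
    G (a * x + b * y) t ≤ a * G x t + b * G y t := by
  simpa using (G_conv ht).2 (mem_univ x) (mem_univ y) ha hb hab

lemma G_one (t : ℝ) : G 1 t = 0 := by simp [G]

lemma G_two {t : ℝ} (ht : 0 < t) : G 2 t = 0 := by
  have := G_rec (x := 1) ht
  rw [G_one] at this
  norm_num at this; exact this

lemma G_three {t : ℝ} (ht : 0 < t) : G 3 t = t⁻¹ * (exp (-(1 * t)) - exp (-(2 * t))) := by
  have := G_rec (x := 2) ht
  rw [G_two ht] at this
  norm_num at this ⊢; exact this

lemma G_nonneg {x t : ℝ} (ht : 0 < t) (hx : x ≤ 1) : 0 ≤ G x t := by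
  have h2 : (0:ℝ) < 2 - x := by linarith
  have := G_cvx ht x 2 (1 / (2 - x)) ((1 - x) / (2 - x))
    (by positivity) (div_nonneg (by linarith) h2.le) (by field_simp; ring)
  rw [G_two ht] at this
  rw [show 1 / (2 - x) * x + (1 - x) / (2 - x) * 2 = 1 by field_simp; ring, G_one] at this
  rw [mul_zero, add_zero] at this
  exact nonneg_of_mul_nonneg_right this (by positivity)

lemma G_abs {x t : ℝ} (ht : 0 < t) (h1 : 1 ≤ x) (h2 : x ≤ 2) :
    |G x t| ≤ t⁻¹ * (exp (-(1 * t)) - exp (-(2 * t))) := by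
  have A := G_cvx ht 1 2 (2 - x) (x - 1)
    (by linarith) (by linarith) (by ring)
  have h3 : (0:ℝ) < 3 - x := by linarith
  have B := G_cvx ht x 3 (1 / (3 - x)) ((2 - x) / (3 - x))
    (by positivity) (div_nonneg (by linarith) h3.le) (by field_simp; ring)
  rw [G_two ht, G_one] at A
  rw [show (2 - x) * 1 + (x - 1) * 2 = x by ring] at A
  rw [show 1 / (3 - x) * x + (2 - x) / (3 - x) * 3 = 2 by field_simp; ring, G_two ht] at B
  have C : 0 ≤ G 3 t := by
    rw [G_three ht]
    apply mul_nonneg (by positivity)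
    have : exp (-(2 * t)) ≤ exp (-(1 * t)) := exp_le_exp.2 (by linarith)
    linarith
  have D : 0 ≤ G x t + (2 - x) * G 3 t := by
    have : 0 ≤ (3 - x) * (1 / (3 - x) * G x t + (2 - x) / (3 - x) * G 3 t) := 
      mul_nonneg h3.le B
    have e : (3 - x) * (1 / (3 - x) * G x t + (2 - x) / (3 - x) * G 3 t) 
      = G x t + (2 - x) * G 3 t := by field_simp
    rwa [e] at this
  rw [← G_three ht, abs_le]
  constructor <;> nlinarith

lemma G_meas : Measurable (Function.uncurry G) := by
  unfold G Function.uncurry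
  fun_prop

lemma G_int_add {x : ℝ} (hx : 0 < x) :
    IntegrableOn (G (x + 1)) (Ioi 0) ↔ IntegrableOn (G x) (Ioi 0) := by
  have hf := frul_int one_pos hx
  have : IntegrableOn (G (x + 1)) (Ioi 0) ↔
      IntegrableOn (fun t => G x t + t⁻¹ * (exp (-(1 * t)) - exp (-(x * t)))) (Ioi 0) :=
    integrableOn_congr_fun (fun t ht => G_rec ht) measurableSet_Ioi
  rw [this]
  constructor
  · intro h
    have := h.sub hf
    refine this.congr (Eventually.of_forall fun t => ?_)
    simp
  · intro h
    exact h.add hf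

lemma G_int_12 {x : ℝ} (h1 : 1 ≤ x) (h2 : x ≤ 2) : IntegrableOn (G x) (Ioi 0) := by
  refine Integrable.mono' (frul_int one_pos two_pos) ?_ ?_
  · exact (G_meas.comp (measurable_const.prodMk measurable_id)).aestronglyMeasurable
  · exact (ae_restrict_mem measurableSet_Ioi).mono fun t ht => G_abs ht h1 h2

lemma G_int {x : ℝ} (hx : 0 < x) : IntegrableOn (G x) (Ioi 0) := by
  have key : ∀ n : ℕ, ∀ y : ℝ, 0 < y → y ≤ n + 1 → IntegrableOn (G y) (Ioi 0) := by
    intro n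
    induction n with
    | zero =>
      intro y hy hy1
      norm_num at hy1
      exact (G_int_add hy).1 (G_int_12 (by linarith) (by linarith))
    | succ n ih =>
      intro y hy hy1
      rcases le_or_gt y 1 with h | h
      · exact (G_int_add hy).1 (G_int_12 (by linarith) (by linarith))
      · have := (G_int_add (x := y - 1) (by linarith)).2
          (ih (y - 1) (by linarith) (by push_cast at hy1; linarith))
        simpa using this
  obtain ⟨n, hn⟩ := exists_nat_ge x
  exact key n x hx (by linarith)

lemma malmsten {x : ℝ} (hx : 0 < x) : ∫ t in Ioi (0:ℝ), G x t = log (Gamma x) := by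
  have := eq_Gamma_of_log_convex (f := fun x => exp (∫ t in Ioi (0:ℝ), G x t)) ?_ ?_ ?_ ?_ hx
  · rw [← this, log_exp]
  · refine ⟨convex_Ioi 0, fun x hx y hy a b ha hb hab => ?_⟩
    simp only [Function.comp_apply, log_exp, smul_eq_mul]
    have hx : 0 < x := hx
    have hy : 0 < y := hy
    have hxy : 0 < a * x + b * y := (convex_Ioi (0:ℝ)) hx hy ha hb hab
    rw [← integral_const_mul, ← integral_const_mul, ← integral_add
      ((G_int hx).const_mul a) ((G_int hy).const_mul b)]
    refine setIntegral_mono_on (G_int hxy) (((G_int hx).const_mul a).add ((G_int hy).const_mul b))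
      measurableSet_Ioi fun t ht => ?_
    simpa using (G_conv ht).2 (mem_univ x) (mem_univ y) ha hb hab
  · intro y hy
    rw [setIntegral_congr_fun measurableSet_Ioi (fun t ht => G_rec (x := y) ht),
      integral_add (G_int hy) (frul_int one_pos hy), frul_val one_pos hy, exp_add, div_one,
      exp_log hy, mul_comm]
  · intro y _; exact exp_pos _
  · simp [G_one]

lemma inner_int {t : ℝ} (ht : 0 < t) :
    ∫ x in (0:ℝ)..1, G x t * sin (2 * π * x) = 
      (4 * π^2 * (1 - Real.exp (-t)) - t^2 * Real.exp (-t))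
            / (2 * π * t * (4 * π^2 + t^2)) := by
  have h := (one_sub_pos ht).ne'
  have hpi := pi_pos.ne'
  have hq : 4 * π^2 + t^2 ≠ 0 := by positivity
  have key : ∀ x ∈ uIcc (0:ℝ) 1, HasDerivAt (fun x : ℝ => 
      t⁻¹ * (exp (-t) * (-(x - 1) * cos (2 * π * x) / (2 * π) + sin (2 * π * x) / (4 * π^2))
       + (exp (-t) * cos (2 * π * x) / (2 * π) - exp (-(x * t)) * 
          (t * sin (2 * π * x) + 2 * π * cos (2 * π * x)) / (4 * π^2 + t^2)) / (1 - exp (-t))))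
      (G x t * sin (2 * π * x)) x := by
    intro x _
    have hl : HasDerivAt (fun x : ℝ => 2 * π * x) (2 * π) x := by
      simpa using (hasDerivAt_id x).const_mul (2 * π)
    have hs := hl.sin
    have hc := hl.cos
    have he : HasDerivAt (fun x : ℝ => exp (-(x * t))) (exp (-(x * t)) * (-t)) x := by
      have : HasDerivAt (fun x : ℝ => -(x * t)) (-t) x := by
        have h0 := (hasDerivAt_mul_const (x := x) t).neg
        exact h0
      exact this.exp
    have hx1 : HasDerivAt (fun x : ℝ => -(x - 1)) (-1) x := 
      ((hasDerivAt_id x).sub_const 1).neg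
    have := (((((hx1.mul hc).div_const (2 * π)).add (hs.div_const (4 * π^2))).const_mul 
      (exp (-t))).add ((((hc.const_mul (exp (-t))).div_const (2 * π)).sub 
        ((he.mul ((hs.const_mul t).add (hc.const_mul (2 * π)))).div_const 
          (4 * π^2 + t^2))).div_const (1 - exp (-t)))).const_mul t⁻¹
    refine this.congr_deriv ?_
    unfold G
    simp only [Pi.add_apply, Pi.mul_apply]
    field_simp
    ring
  rw [intervalIntegral.integral_eq_sub_of_hasDerivAt key]
  · simp
    field_simp
    ring
  · apply Continuous.intervalIntegrable
    unfold G
    fun_prop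

lemma logGamma_int : IntegrableOn (fun x => log (Gamma x)) (Ioc 0 1) := by
  have h1 : IntegrableOn (fun x : ℝ => log (Gamma (x + 1))) (Ioc 0 1) := by
    apply IntegrableOn.mono_set (t := Icc 0 1) _ Ioc_subset_Icc_self
    apply ContinuousOn.integrableOn_compact isCompact_Icc
    intro x hx
    have hx1 : 0 < x + 1 := by linarith [hx.1]
    apply ContinuousAt.continuousWithinAt
    have hG : ContinuousAt Gamma (x + 1) := (differentiableAt_Gamma fun m => by
      have : (0:ℝ) ≤ m := m.cast_nonneg
      linarith).continuousAt
    have : ContinuousAt (fun x : ℝ => Gamma (x + 1)) x := 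
      ContinuousAt.comp (f := fun x : ℝ => x + 1) (g := Gamma) hG (by fun_prop)
    exact this.log (Gamma_pos_of_pos hx1).ne'
  have h2 : IntegrableOn log (Ioc (0:ℝ) 1) := 
    (intervalIntegrable_iff_integrableOn_Ioc_of_le zero_le_one).1
      intervalIntegral.intervalIntegrable_log'
  refine (h1.sub h2).congr ?_
  refine (ae_restrict_mem measurableSet_Ioc).mono fun x hx => ?_
  have hx : 0 < x := hx.1
  simp only [Pi.sub_apply]
  rw [Gamma_add_one hx.ne', log_mul hx.ne' (Gamma_pos_of_pos hx).ne']
  ring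

lemma prod_int : Integrable (Function.uncurry fun x t => G x t * sin (2 * π * x))
    ((volume.restrict (Ioc (0:ℝ) 1)).prod (volume.restrict (Ioi (0:ℝ)))) := by
  have hG : Integrable (Function.uncurry G)
      ((volume.restrict (Ioc (0:ℝ) 1)).prod (volume.restrict (Ioi (0:ℝ)))) := by
    rw [integrable_prod_iff G_meas.aestronglyMeasurable]
    constructor
    · exact (ae_restrict_mem measurableSet_Ioc).mono fun x hx => G_int hx.1
    · refine Integrable.congr logGamma_int ?_
      refine (ae_restrict_mem measurableSet_Ioc).mono fun x hx => ?_
      simp only [Function.uncurry]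
      rw [← malmsten hx.1]
      refine setIntegral_congr_fun measurableSet_Ioi fun t ht => ?_
      rw [norm_eq_abs, abs_of_nonneg (G_nonneg ht hx.2)]
  refine hG.mono ?_ (Eventually.of_forall fun p => ?_)
  · have hm : Measurable fun p : ℝ × ℝ => Function.uncurry G p * sin (2 * π * p.1) :=
      G_meas.mul (by fun_prop)
    exact hm.aestronglyMeasurable
  · simp only [Function.uncurry, norm_mul]
    exact mul_le_of_le_one_right (norm_nonneg _) (abs_sin_le_one _)

end MalmstenAux

open MalmstenAux MeasureTheory in
theorem integral_logGamma_sin_eq :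
    ∫ x in (0:ℝ)..1, Real.log (Real.Gamma x) * Real.sin (2 * π * x)
      = ∫ t in Set.Ioi (0:ℝ),
          (4 * π^2 * (1 - Real.exp (-t)) - t^2 * Real.exp (-t))
            / (2 * π * t * (4 * π^2 + t^2)) := by
  rw [← setIntegral_congr_fun measurableSet_Ioi (fun t ht => inner_int ht)]
  simp only [intervalIntegral.integral_of_le zero_le_one]
  rw [← integral_integral_swap prod_int]
  refine setIntegral_congr_fun measurableSet_Ioc fun x hx => ?_
  rw [integral_mul_const, malmsten hx.1]
end

section
/- ∫₀^{1/2} log Γ(x) dx = (5/24)·log 2 + (1/4)·log π + (3/2)·log A, where A is the Glaisher–Kinkelin constant. -/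
open Real
noncomputable def glaisher : ℝ := Real.exp (1/12 - (deriv riemannZeta (-1)).re)

open Filter Topology

/-- third difference -/
def D3 {K : Type*} [Field K] (g : ℕ → K) (m : ℕ) : K :=
  g m - 3 * g (m+1) + 3 * g (m+2) - g (m+3)

/-- boundary term of the Euler transform -/
def BT {K : Type*} [Field K] (g : ℕ → K) (m : ℕ) : K :=
  (7 * g m - 4 * g (m+1) + g (m+2)) / 8

lemma euler_transform {K : Type*} [Field K] [CharZero K] (g : ℕ → K) (N : ℕ) :
    ∑ m ∈ Finset.range N, (-1)^m * g m =
      BT g 0 - (-1)^N * BT g N + 1/8 * ∑ m ∈ Finset.range N, (-1)^m * D3 g m := by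
  induction N with
  | zero => simp
  | succ n ih =>
    rw [Finset.sum_range_succ, Finset.sum_range_succ, ih]
    simp only [BT, D3, pow_succ]
    ring

lemma diff_bound {h h' : ℝ → ℂ} {x C : ℝ} (hd : ∀ y, x ≤ y → HasDerivAt h (h' y) y)
    (hC : ∀ y, x ≤ y → ‖h' y‖ ≤ C) (y : ℝ) (hy : x ≤ y) : ‖h y - h (y+1)‖ ≤ C := by
  have := Convex.norm_image_sub_le_of_norm_hasDerivWithin_le (s := Set.Ici x) (x := y + 1) (y := y)
    (fun z hz => (hd z hz).hasDerivWithinAt) (fun z hz => hC z hz) (convex_Ici x)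
    (by simp; linarith) (by simpa using hy)
  simpa using this

lemma diff_deriv {h h' : ℝ → ℂ} {x : ℝ} (hd : ∀ y, x ≤ y → HasDerivAt h (h' y) y)
    (y : ℝ) (hy : x ≤ y) :
    HasDerivAt (fun y => h y - h (y+1)) (h' y - h' (y+1)) y := by
  refine (hd y hy).sub ?_
  exact (hd (y+1) (by linarith)).comp_add_const y 1

lemma cpow_deriv (a : ℂ) (c : ℂ) (x : ℝ) (hx : 1 ≤ x) (y : ℝ) (hy : x ≤ y) :
    HasDerivAt (fun y : ℝ => c * (y:ℂ)^a) ((c * a) * (y:ℂ)^(a-1)) y := by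
  have h : HasDerivAt (fun z : ℂ => z ^ a) (a * (y:ℂ)^(a-1) * 1) (y:ℂ) := by
    refine (hasDerivAt_id (y:ℂ)).cpow_const ?_
    exact Complex.ofReal_mem_slitPlane.2 (by linarith)
  have h2 := (h.comp_ofReal).const_mul c
  rwa [mul_one, ← mul_assoc] at h2

lemma D3_bound (s : ℂ) (hs : -(3/2) ≤ s.re) (hs' : ‖s‖ ≤ 10) (m : ℕ) :
    ‖D3 (fun n : ℕ => ((n:ℂ)+1)^(-s)) m‖ ≤ 1320 * (1 / ((m:ℝ)+1)^(3/2:ℝ)) := by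
  set x : ℝ := (m:ℝ)+1 with hx
  have hx1 : 1 ≤ x := by simp [hx]
  have d0 := cpow_deriv (-s) 1 x hx1
  have d1 := cpow_deriv (-s-1) (1 * (-s)) x hx1
  have d2 := cpow_deriv (-s-1-1) (1 * (-s) * (-s-1)) x hx1
  have e0 := diff_deriv d0
  have e1 := diff_deriv d1
  have e2 := diff_deriv e0
  have b : ∀ y, x ≤ y → ‖1 * (-s) * (-s-1) * (-s-1-1) * (y:ℂ)^(-s-1-1-1)‖ ≤
      1320 * (1 / x^(3/2:ℝ)) := by
    intro y hy
    have hy0 : 0 < y := by linarith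
    rw [norm_mul, Complex.norm_cpow_eq_rpow_re_of_pos hy0]
    gcongr
    · rw [norm_mul, norm_mul, one_mul, norm_neg]
      have h1 : ‖-s-1‖ ≤ 11 := by
        calc ‖-s-1‖ ≤ ‖-s‖ + ‖(1:ℂ)‖ := norm_sub_le _ _
          _ ≤ 11 := by simp; linarith
      have h2 : ‖-s-1-1‖ ≤ 12 := by
        calc ‖-s-1-1‖ ≤ ‖-s-1‖ + ‖(1:ℂ)‖ := norm_sub_le _ _
          _ ≤ 12 := by simp; linarith
      calc ‖s‖ * ‖-s-1‖ * ‖-s-1-1‖ ≤ 10 * 11 * 12 := by gcongr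
        _ = 1320 := by norm_num
    · rw [one_div, ← Real.rpow_neg (by linarith)]
      calc y ^ (-s-1-1-1).re ≤ y ^ (-(3/2):ℝ) := by
            apply Real.rpow_le_rpow_of_exponent_le (by linarith)
            simp; linarith
        _ ≤ x ^ (-(3/2):ℝ) := by
            apply Real.rpow_le_rpow_of_nonpos (by linarith) hy (by norm_num)
  have b1 := diff_bound d2 b
  have b2 := diff_bound e1 b1
  have b3 := diff_bound e2 b2 x le_rfl
  convert b3 using 2
  simp only [D3, hx]
  push_cast
  ring_nf

lemma summable_bound : Summable (fun m : ℕ => 1320 * (1 / ((m:ℝ)+1)^(3/2:ℝ))) := by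
  apply Summable.mul_left
  have := (Real.summable_one_div_nat_rpow (p := 3/2)).2 (by norm_num)
  have := (summable_nat_add_iff 1).2 this
  simpa using this

/-- The region -/
def UU : Set ℂ := {s | -(3/2) < s.re} ∩ Metric.ball 0 10

lemma UU_open : IsOpen UU :=
  (isOpen_lt continuous_const Complex.continuous_re).inter Metric.isOpen_ball

lemma UU_convex : Convex ℝ UU :=
  (convex_halfSpace_re_gt _).inter (convex_ball _ _)

noncomputable def FF (m : ℕ) (s : ℂ) : ℂ := (-1)^m * D3 (fun n : ℕ => ((n:ℂ)+1)^(-s)) m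

lemma FF_bound (m : ℕ) (s : ℂ) (hs : s ∈ UU) : ‖FF m s‖ ≤ 1320 * (1 / ((m:ℝ)+1)^(3/2:ℝ)) := by
  have := D3_bound s hs.1.le (by have := hs.2; rw [mem_ball_zero_iff] at this; exact this.le) m
  simpa [FF] using this

lemma cpow_hd (n : ℕ) (s : ℂ) : HasDerivAt (fun s : ℂ => ((n:ℂ)+1)^(-s))
    (-(((n:ℂ)+1)^(-s) * Complex.log ((n:ℂ)+1))) s := by
  have h := (hasDerivAt_neg s).const_cpow (c := (n:ℂ)+1) (Or.inl (by exact_mod_cast Nat.succ_ne_zero n))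
  convert h using 1
  ring

lemma FF_hd (m : ℕ) (s : ℂ) : HasDerivAt (FF m)
    ((-1)^m * D3 (fun n : ℕ => -(((n:ℂ)+1)^(-s) * Complex.log ((n:ℂ)+1))) m) s := by
  have := ((((cpow_hd m s).sub ((cpow_hd (m+1) s).const_mul 3)).add ((cpow_hd (m+2) s).const_mul 3)).sub
    (cpow_hd (m+3) s)).const_mul ((-1)^m)
  exact this

lemma BT_hd (s : ℂ) : HasDerivAt (fun s : ℂ => BT (fun n : ℕ => ((n:ℂ)+1)^(-s)) 0)
    (BT (fun n : ℕ => -(((n:ℂ)+1)^(-s) * Complex.log ((n:ℂ)+1))) 0) s := by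
  have := ((((cpow_hd 0 s).const_mul 7).sub ((cpow_hd (0+1) s).const_mul 4)).add ((cpow_hd (0+2) s))).div_const 8
  exact this

/-- The continued eta function -/
noncomputable def EE (s : ℂ) : ℂ :=
  BT (fun n : ℕ => ((n:ℂ)+1)^(-s)) 0 + 1/8 * ∑' m, FF m s

lemma FF_sum_diff : DifferentiableOn ℂ (fun s => ∑' m, FF m s) UU :=
  Complex.differentiableOn_tsum_of_summable_norm summable_bound
    (fun m s _ => (FF_hd m s).differentiableAt.differentiableWithinAt) UU_open FF_bound

lemma EE_diff : DifferentiableOn ℂ EE UU := by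
  intro s hs
  exact ((BT_hd s).differentiableAt.differentiableWithinAt).add ((FF_sum_diff s hs).const_mul _)

lemma neg_one_mem : (-1:ℂ) ∈ UU := by
  constructor
  · simp; norm_num
  · simp

/-- g(n) = (n+1) log (n+1) -/
noncomputable def gg (n : ℕ) : ℝ := ((n:ℝ)+1) * Real.log ((n:ℝ)+1)

lemma gg_eq (n : ℕ) : -(((n:ℂ)+1)^(-(-1:ℂ)) * Complex.log ((n:ℂ)+1)) = ((-gg n : ℝ) : ℂ) := by
  have : ((n:ℂ)+1) = (((n:ℝ)+1 : ℝ) : ℂ) := by push_cast; rfl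
  rw [neg_neg, Complex.cpow_one, this, ← Complex.ofReal_log (by positivity)]
  simp [gg]

lemma EE_deriv : ∃ T : ℝ, HasSum (fun m => (-1)^m * D3 gg m) T ∧
    deriv EE (-1) = ((-(BT gg 0 + 1/8 * T) : ℝ) : ℂ) := by
  have hs := Complex.hasSum_deriv_of_summable_norm summable_bound
    (fun m s _ => (FF_hd m s).differentiableAt.differentiableWithinAt) UU_open FF_bound neg_one_mem
  have h1 : ∀ m, deriv (FF m) (-1) = ((-((-1)^m * D3 gg m) : ℝ) : ℂ) := by
    intro m
    rw [(FF_hd m (-1)).deriv]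
    simp only [gg_eq, D3]
    push_cast
    ring
  simp only [h1] at hs
  have hsr := Complex.hasSum_re hs
  simp only [Complex.ofReal_re] at hsr
  refine ⟨-(deriv (fun w => ∑' m, FF m w) (-1)).re, by simpa using hsr.neg, ?_⟩
  have hu := hs.unique (Complex.hasSum_ofReal.2 hsr)
  have hd : DifferentiableAt ℂ (fun s => ∑' m, FF m s) (-1) :=
    FF_sum_diff.differentiableAt (UU_open.mem_nhds neg_one_mem)
  have := (BT_hd (-1)).add (hd.hasDerivAt.const_mul (1/8))
  have h2 : deriv EE (-1) = _ := this.deriv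
  rw [h2, hu]
  simp only [gg_eq, BT]
  push_cast
  simp
  ring

lemma EE_eq_of_one_lt (s : ℂ) (hs : 1 < s.re) (hU : s ∈ UU) :
    EE s = (1 - 2^(1-s)) * riemannZeta s := by
  have hZ : HasSum (fun n : ℕ => ((n:ℂ)+1)^(-s)) (riemannZeta s) := by
    rw [zeta_eq_tsum_one_div_nat_add_one_cpow hs]
    have h := (summable_nat_add_iff 1).2 (Complex.summable_one_div_nat_cpow.2 hs)
    have h' := h.hasSum
    simpa [Complex.cpow_neg] using h'
  have hZt := hZ.tendsto_sum_nat
  have hterm := hZ.summable.tendsto_atTop_zero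
  have h2n : Tendsto (fun n : ℕ => 2 * n) atTop atTop :=
    tendsto_id.const_mul_atTop' (by norm_num)
  have key : ∀ n : ℕ, ∑ m ∈ Finset.range (2*n), (-1:ℂ)^m * ((m:ℂ)+1)^(-s) =
      ∑ m ∈ Finset.range (2*n), ((m:ℂ)+1)^(-s)
      - 2^(1-s) * ∑ m ∈ Finset.range n, ((m:ℂ)+1)^(-s) := by
    intro n
    induction n with
    | zero => simp
    | succ n ih =>
      rw [show 2*(n+1) = 2*n+1+1 by ring]
      simp only [Finset.sum_range_succ] at ih ⊢
      rw [ih]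
      have h2 : (2:ℂ)^(1-s) * ((n:ℂ)+1)^(-s) = 2 * (((2*n+1:ℕ):ℂ)+1)^(-s) := by
        have := Complex.natCast_mul_natCast_cpow 2 (n+1) (-s)
        push_cast at this ⊢
        rw [show (2:ℂ)*n+1+1 = 2 * (n+1) by ring, this, sub_eq_add_neg,
          Complex.cpow_add _ _ two_ne_zero, Complex.cpow_one]
        ring
      rw [mul_add, h2]
      simp only [pow_succ, pow_mul]
      norm_num
      ring
  have lim1 : Tendsto (fun n : ℕ => ∑ m ∈ Finset.range (2*n), (-1:ℂ)^m * ((m:ℂ)+1)^(-s)) atTop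
      (𝓝 (riemannZeta s - 2^(1-s) * riemannZeta s)) := by
    simp only [key]
    exact (hZt.comp h2n).sub (hZt.const_mul _)
  have hF : Summable (fun m => FF m s) :=
    Summable.of_norm_bounded summable_bound (fun m => FF_bound m s hU)
  have hBT : Tendsto (fun N => BT (fun n : ℕ => ((n:ℂ)+1)^(-s)) N) atTop (𝓝 0) := by
    have t1 := hterm.comp (tendsto_add_atTop_nat 1)
    have t2 := hterm.comp (tendsto_add_atTop_nat 2)
    have := (((hterm.const_mul 7).sub (t1.const_mul 4)).add t2).div_const 8
    simpa [BT, Function.comp_def] using this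
  have lim2 : Tendsto (fun n : ℕ => ∑ m ∈ Finset.range (2*n), (-1:ℂ)^m * ((m:ℂ)+1)^(-s)) atTop
      (𝓝 (EE s)) := by
    have := fun n : ℕ => euler_transform (fun n : ℕ => ((n:ℂ)+1)^(-s)) (2*n)
    simp only [this]
    have l := (tendsto_const_nhds (x := BT (fun n : ℕ => ((n:ℂ)+1)^(-s)) 0)).sub
      (hBT.comp h2n) |>.add ((hF.hasSum.tendsto_sum_nat.comp h2n).const_mul (1/8))
    simpa [EE, FF, Function.comp_def] using l
  rw [tendsto_nhds_unique lim2 lim1]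
  ring

lemma EE_eventually : EE =ᶠ[𝓝 (-1)] fun s => (1 - 2^(1-s)) * riemannZeta s := by
  let W1 : Set ℂ := UU ∩ {s | 0 < s.im}
  let W2 : Set ℂ := UU ∩ {s | s.re < 1}
  have o1 : IsOpen W1 := UU_open.inter (isOpen_lt continuous_const Complex.continuous_im)
  have o2 : IsOpen W2 := UU_open.inter (isOpen_lt Complex.continuous_re continuous_const)
  have c1 : IsPreconnected W1 := (UU_convex.inter (convex_halfSpace_im_gt 0)).isPreconnected
  have c2 : IsPreconnected W2 := (UU_convex.inter (convex_halfSpace_re_lt 1)).isPreconnected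
  have mI : Complex.I ∈ UU := by
    constructor
    · simp
    · simp
  have c : IsPreconnected (W1 ∪ W2) := by
    refine IsPreconnected.union Complex.I ⟨mI, by simp⟩ ⟨mI, by simp⟩ c1 c2
  have o := o1.union o2
  have sub : W1 ∪ W2 ⊆ UU := by
    rintro s (h | h) <;> exact h.1
  have ne1 : ∀ s ∈ W1 ∪ W2, s ≠ 1 := by
    rintro s (h | h) rfl
    · have := h.2; simp at this
    · have := h.2; simp at this
  have a1 : AnalyticOnNhd ℂ EE (W1 ∪ W2) := (EE_diff.mono sub).analyticOnNhd o
  have a2 : AnalyticOnNhd ℂ (fun s => (1 - 2^(1-s)) * riemannZeta s) (W1 ∪ W2) := by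
    refine DifferentiableOn.analyticOnNhd (fun s hs => ?_) o
    refine (DifferentiableAt.mul ?_ (differentiableAt_riemannZeta (ne1 s hs))).differentiableWithinAt
    exact (differentiableAt_const _).sub
      (((differentiableAt_const _).sub differentiableAt_id).const_cpow (Or.inl two_ne_zero))
  have m0 : (2 + Complex.I : ℂ) ∈ UU := by
    constructor
    · simp; norm_num
    · have : ‖(2 + Complex.I : ℂ)‖ ≤ ‖(2:ℂ)‖ + ‖Complex.I‖ := norm_add_le _ _
      simp at this ⊢
      linarith
  have ev : EE =ᶠ[𝓝 (2 + Complex.I)] fun s => (1 - 2^(1-s)) * riemannZeta s := by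
    have o3 : IsOpen {s : ℂ | 1 < s.re} := isOpen_lt continuous_const Complex.continuous_re
    filter_upwards [UU_open.mem_nhds m0, o3.mem_nhds (by simp)] with s h1 h2
    exact EE_eq_of_one_lt s h2 h1
  have eq := a1.eqOn_of_preconnected_of_eventuallyEq a2 c (Or.inl ⟨m0, by simp⟩) ev
  exact eq.eventuallyEq_of_mem (o.mem_nhds (Or.inr ⟨neg_one_mem, by simp⟩))

lemma eta_deriv : deriv EE (-1) = -3 * deriv riemannZeta (-1) - (Real.log 2 : ℝ) / 3 := by
  rw [EE_eventually.deriv_eq]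
  have h1 : HasDerivAt (fun s : ℂ => (1:ℂ) - 2^(1-s)) (4 * (Real.log 2 : ℝ)) (-1) := by
    have := (((hasDerivAt_id (-1:ℂ)).const_sub 1).const_cpow (c := 2) (Or.inl two_ne_zero)).const_sub 1
    have e : (4 * (Real.log 2 : ℝ) : ℂ) = -(2 ^ (1 - id (-1:ℂ)) * Complex.log 2 * -1) := by
      have : (1:ℂ) - id (-1) = (2:ℕ) := by simp; norm_num
      rw [this, Complex.cpow_natCast, Complex.ofReal_log (by norm_num)]
      push_cast
      ring
    rw [e]
    exact this
  have h2 := (differentiableAt_riemannZeta (s := -1) (by norm_num)).hasDerivAt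
  have hz : riemannZeta (-1) = -1/12 := by
    have := riemannZeta_neg_nat_eq_bernoulli 1
    have hb : bernoulli 2 = 1/6 := by simp [bernoulli]
    norm_num [hb] at this
    rw [this]
    norm_num
  have h3 : deriv (fun s : ℂ => (1 - 2^(1-s)) * riemannZeta s) (-1) = _ := (h1.mul h2).deriv
  rw [h3, hz]
  have : (1:ℂ) - (-1) = (2:ℕ) := by norm_num
  rw [this, Complex.cpow_natCast]
  push_cast
  ring

lemma logGamma_feq {y : ℝ} (hy : 0 < y) :
    (Real.log ∘ Real.Gamma) (y + 1) = (Real.log ∘ Real.Gamma) y + Real.log y := by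
  simp only [Function.comp]
  rw [Real.Gamma_add_one hy.ne', Real.log_mul hy.ne' (Real.Gamma_pos_of_pos hy).ne', add_comm]

lemma logGamma_intble : IntervalIntegrable (fun x => Real.log (Real.Gamma x))
    MeasureTheory.volume 0 (1/2) := by
  have h1 : IntervalIntegrable (fun x => Real.log (Real.Gamma (x+1)) - Real.log x)
      MeasureTheory.volume 0 (1/2) := by
    refine IntervalIntegrable.sub ?_ intervalIntegral.intervalIntegrable_log'
    apply ContinuousOn.intervalIntegrable
    intro x hx
    rw [Set.uIcc_of_le (by norm_num)] at hx
    have hx0 : 0 < x + 1 := by linarith [hx.1]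
    apply ContinuousAt.continuousWithinAt
    have hc : ContinuousAt Real.Gamma (x+1) :=
      (Real.differentiableAt_Gamma (fun m => by
        have : (0:ℝ) ≤ m := Nat.cast_nonneg m
        linarith)).continuousAt
    exact ContinuousAt.log (ContinuousAt.comp (f := fun x : ℝ => x + 1) hc (by fun_prop))
      (Real.Gamma_pos_of_pos hx0).ne'
  refine h1.congr ?_
  intro x hx
  rw [Set.uIoc_of_le (by norm_num)] at hx
  have := logGamma_feq hx.1
  simp only [Function.comp] at this
  simp only
  linarith

lemma log_add_intble (m : ℕ) : IntervalIntegrable (fun x : ℝ => Real.log (x + m))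
    MeasureTheory.volume 0 (1/2) := by
  have := (intervalIntegral.intervalIntegrable_log' (a := 0 + m) (b := 1/2 + m)).comp_add_right (m:ℝ)
  simpa using this

lemma seq_int (n : ℕ) : ∫ x in (0:ℝ)..(1/2), Real.BohrMollerup.logGammaSeq x n =
    1/8 * Real.log n + 1/2 * Real.log n.factorial -
      ∑ m ∈ Finset.range (n+1), (((m:ℝ)+1/2) * Real.log ((m:ℝ)+1/2) - m * Real.log m - 1/2) := by
  unfold Real.BohrMollerup.logGammaSeq
  have i1 : IntervalIntegrable (fun x : ℝ => x * Real.log n) MeasureTheory.volume 0 (1/2) :=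
    (by fun_prop : Continuous (fun x : ℝ => x * Real.log n)).intervalIntegrable _ _
  have i2 : IntervalIntegrable (fun x : ℝ => Real.log n.factorial) MeasureTheory.volume 0 (1/2) :=
    intervalIntegrable_const
  rw [intervalIntegral.integral_sub (i1.add i2), intervalIntegral.integral_add i1 i2,
    intervalIntegral.integral_finsetSum (fun m _ => log_add_intble m)]
  · have : ∀ m : ℕ, ∫ x in (0:ℝ)..(1/2), Real.log (x + m) =
        ((m:ℝ)+1/2) * Real.log ((m:ℝ)+1/2) - m * Real.log m - 1/2 := by
      intro m
      rw [intervalIntegral.integral_comp_add_right (fun x => Real.log x), integral_log]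
      rw [zero_add, add_comm (1/2:ℝ)]
      ring
    simp only [this]
    rw [intervalIntegral.integral_mul_const, integral_id, intervalIntegral.integral_const, smul_eq_mul]
    ring
  · have := IntervalIntegrable.sum (Finset.range (n+1)) (fun m _ => log_add_intble m)
    simpa [Finset.sum_fn] using this

lemma sum_eq (n : ℕ) :
    ∑ m ∈ Finset.range (n+1), (((m:ℝ)+1/2) * Real.log ((m:ℝ)+1/2) - m * Real.log m - 1/2) =
    1/2 * ∑ m ∈ Finset.range (2*n+1), (-1)^m * gg m - (n+1)/2 * (1 + Real.log 2) := by
  have hl : ∀ m : ℕ, Real.log ((m:ℝ)+1/2) = Real.log (2*m+1) - Real.log 2 := by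
    intro m
    rw [← Real.log_div (by positivity) (by norm_num)]
    congr 1; ring
  have hl2 : ∀ m : ℕ, Real.log ((m:ℝ)+1) = Real.log (2*m+1+1) - Real.log 2 := by
    intro m
    rw [← Real.log_div (by positivity) (by norm_num)]
    congr 1; ring
  induction n with
  | zero =>
    have := hl 0
    simp at this
    simp [gg]
    ring
  | succ n ih =>
    rw [Finset.sum_range_succ, ih, show 2*(n+1)+1 = 2*n+1+1+1 by ring]
    simp only [Finset.sum_range_succ]
    rw [hl]
    simp only [gg, pow_succ, pow_mul]
    push_cast
    rw [hl2]
    norm_num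
    ring_nf

lemma seq_tendsto : Tendsto (fun n : ℕ => ∫ x in (0:ℝ)..(1/2), Real.BohrMollerup.logGammaSeq x n)
    atTop (𝓝 (∫ x in (0:ℝ)..(1/2), Real.log (Real.Gamma x))) := by
  refine intervalIntegral.tendsto_integral_filter_of_dominated_convergence
    (fun x => |Real.log (Real.Gamma x)| + 1) ?_ ?_ ?_ ?_
  · refine Eventually.of_forall fun n => ?_
    apply Measurable.aestronglyMeasurable
    unfold Real.BohrMollerup.logGammaSeq
    fun_prop
  · filter_upwards [eventually_ge_atTop 1] with n hn
    refine Eventually.of_forall fun x hx => ?_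
    rw [Set.uIoc_of_le (by norm_num)] at hx
    have h1 := Real.BohrMollerup.le_logGammaSeq Real.convexOn_log_Gamma logGamma_feq hx.1
      (by linarith [hx.2]) n
    have h2 := Real.BohrMollerup.ge_logGammaSeq (n := n) Real.convexOn_log_Gamma logGamma_feq hx.1
      (by omega)
    simp only [Function.comp, Real.Gamma_one, Real.log_one, zero_add] at h1 h2
    have hn' : (1:ℝ) ≤ n := by exact_mod_cast hn
    have h3 : Real.log ((n:ℝ)+1) - Real.log n ≤ 1 := by
      rw [← Real.log_div (by positivity) (by positivity)]
      have := Real.log_le_sub_one_of_pos (x := ((n:ℝ)+1)/n) (by positivity)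
      have h4 : ((n:ℝ)+1)/n - 1 ≤ 1 := by
        rw [sub_le_iff_le_add, div_le_iff₀ (by positivity)]; linarith
      linarith
    have h5 : x * Real.log ((n:ℝ)+1) - x * Real.log n ≤ 1 := by
      rw [← mul_sub]
      have : 0 ≤ Real.log ((n:ℝ)+1) - Real.log n := by
        have := Real.log_le_log (x := (n:ℝ)) (y := n + 1) (by positivity) (by linarith)
        linarith
      nlinarith [hx.1, hx.2]
    rw [Real.norm_eq_abs, abs_le]
    constructor
    · linarith [neg_abs_le (Real.log (Real.Gamma x))]
    · linarith [le_abs_self (Real.log (Real.Gamma x))]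
  · exact logGamma_intble.abs.add intervalIntegrable_const
  · refine Eventually.of_forall fun x hx => ?_
    rw [Set.uIoc_of_le (by norm_num)] at hx
    exact Real.BohrMollerup.tendsto_log_gamma hx.1

lemma boundary_tendsto : Tendsto (fun n : ℕ => 1/8 * Real.log n + 1/2 * Real.log n.factorial
    + (n+1)/2 * (1 + Real.log 2) - 1/2 * BT gg (2*n+1)) atTop
    (𝓝 (3/8 * Real.log 2 + 1/4 * Real.log π + 1/8)) := by
  have hs : Tendsto (fun n : ℕ => Real.log (Stirling.stirlingSeq n)) atTop (𝓝 (1/2 * Real.log π)) := by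
    have := Stirling.tendsto_stirlingSeq_sqrt_pi.log (by positivity)
    rw [Real.log_sqrt pi_pos.le] at this
    convert this using 2; ring
  have hM : Tendsto (fun n : ℕ => (2:ℝ) * n + 2) atTop atTop :=
    tendsto_atTop_add_const_right _ _ (tendsto_natCast_atTop_atTop.const_mul_atTop (by norm_num))
  have l0 : ∀ j : ℝ, Tendsto (fun x : ℝ => Real.log (1 + j / x)) atTop (𝓝 0) := by
    intro j
    have : Tendsto (fun x : ℝ => 1 + j / x) atTop (𝓝 (1 + 0)) :=
      tendsto_const_nhds.add (tendsto_const_nhds.div_atTop tendsto_id)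
    have := this.log (by norm_num)
    simpa using this
  have lj : ∀ j : ℝ, Tendsto (fun x : ℝ => (x + j) * Real.log (1 + j / x)) atTop (𝓝 j) := by
    intro j
    have := (Real.tendsto_mul_log_one_add_div_atTop j).add ((l0 j).const_mul j)
    simp only [mul_zero, add_zero] at this
    refine this.congr fun x => by ring
  have t1 := (lj 1).comp hM
  have t2 := (lj 2).comp hM
  have t3 := (Real.tendsto_mul_log_one_add_div_atTop 1).comp (tendsto_natCast_atTop_atTop (R := ℝ))
  have t4 := (l0 1).comp (tendsto_natCast_atTop_atTop (R := ℝ))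
  have tot := (((((hs.const_mul (1/2)).add (t1.const_mul (1/4))).sub (t2.const_mul (1/16))).sub
    (t3.const_mul (1/2))).sub (t4.const_mul (3/8))).add_const (1/2 + 3/8 * Real.log 2)
  have e : (1/2 * (1/2 * Real.log π) + 1/4 * 1 - 1/16 * 2 - 1/2 * 1 - 3/8 * 0 +
    (1/2 + 3/8 * Real.log 2)) = 3/8 * Real.log 2 + 1/4 * Real.log π + 1/8 := by ring
  rw [e] at tot
  refine tot.congr' ?_
  filter_upwards [eventually_ge_atTop 1] with n hn
  have hn' : (0:ℝ) < n := by exact_mod_cast hn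
  simp only [Function.comp, Stirling.log_stirlingSeq_formula, BT, gg]
  push_cast
  have a1 : Real.log (1 + 1 / (2*(n:ℝ)+2)) = Real.log (2*n+3) - Real.log 2 - Real.log (n+1) := by
    rw [← Real.log_div (by positivity) (by positivity), ← Real.log_div (by positivity) (by positivity)]
    congr 1; field_simp; ring
  have a2 : Real.log (1 + 2 / (2*(n:ℝ)+2)) = Real.log (2*n+4) - Real.log 2 - Real.log (n+1) := by
    rw [← Real.log_div (by positivity) (by positivity), ← Real.log_div (by positivity) (by positivity)]
    congr 1; field_simp; ring
  have a3 : Real.log (1 + 1 / (n:ℝ)) = Real.log (n+1) - Real.log n := by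
    rw [← Real.log_div (by positivity) (by positivity)]
    congr 1; field_simp
  have a4 : Real.log (2 * (n:ℝ)) = Real.log 2 + Real.log n := Real.log_mul (by norm_num) hn'.ne'
  have a5 : Real.log ((n:ℝ) / rexp 1) = Real.log n - 1 := by
    rw [Real.log_div hn'.ne' (Real.exp_pos 1).ne', Real.log_exp]
  have a6 : Real.log (2*(n:ℝ)+1+1) = Real.log 2 + Real.log (n+1) := by
    rw [← Real.log_mul (by norm_num) (by positivity)]; congr 1; ring
  rw [a1, a2, a3, a4, a5, a6, show 2*(n:ℝ)+1+1+1 = 2*n+3 by ring,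
    show 2*(n:ℝ)+1+2+1 = 2*n+4 by ring]
  ring

lemma seq_tendsto' (T : ℝ) (hT : HasSum (fun m => (-1)^m * D3 gg m) T) :
    Tendsto (fun n : ℕ => ∫ x in (0:ℝ)..(1/2), Real.BohrMollerup.logGammaSeq x n)
      atTop (𝓝 (3/8 * Real.log 2 + 1/4 * Real.log π + 1/8 + -1/2 * (BT gg 0 + 1/8 * T))) := by
  have hN : Tendsto (fun n : ℕ => 2 * n + 1) atTop atTop :=
    tendsto_atTop_mono (fun n => by simp only [id]; omega) tendsto_id
  have h1 : Tendsto (fun n : ℕ => -1/2 * (BT gg 0 + 1/8 *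
      ∑ m ∈ Finset.range (2*n+1), (-1)^m * D3 gg m)) atTop (𝓝 (-1/2 * (BT gg 0 + 1/8 * T))) :=
    ((((hT.tendsto_sum_nat).comp hN).const_mul (1/8)).const_add (BT gg 0)).const_mul (-1/2)
  have lim := boundary_tendsto.add h1
  refine lim.congr fun n => ?_
  rw [seq_int, sum_eq, euler_transform gg]
  have hp : (-1:ℝ)^(2*n+1) = -1 := by simp [pow_succ, pow_mul]
  rw [hp]
  ring

theorem integral_logGamma_half :
    ∫ x in (0:ℝ)..(1/2), Real.log (Real.Gamma x)
      = 5/24 * Real.log 2 + 1/4 * Real.log π + 3/2 * Real.log glaisher := by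
  obtain ⟨T, hT, hE⟩ := EE_deriv
  have hη := eta_deriv
  rw [hE] at hη
  have hre := congrArg Complex.re hη
  have hre' : -(BT gg 0 + 1/8 * T) = -3 * (deriv riemannZeta (-1)).re - Real.log 2 / 3 := by
    rw [Complex.ofReal_re] at hre
    rw [hre]
    have : ((Real.log 2 : ℝ) : ℂ) / 3 = ((Real.log 2 / 3 : ℝ) : ℂ) := by push_cast; rfl
    rw [this, Complex.sub_re, Complex.ofReal_re]
    simp
  rw [tendsto_nhds_unique seq_tendsto (seq_tendsto' T hT), glaisher, Real.log_exp]
  clear hre hη hE hT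
  linarith
end
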